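/- Let U be a free open set in M^d and let (φ_i)_{i=1}^∞ be a sequence in the closed unit ball of H^∞(U). Then there exist a subsequence (φ_{i_j})_{j=1}^∞ and a function φ in the closed unit ball of H^∞(U) such that for every n ≥ 1, φ_{i_j} converges to φ uniformly on compact subsets of U ∩ M_n^d. -/

import Mathlib

/- ## Basic framework for free (nc) function theory -/

noncomputable section

/-- A point of `M_n^d`: a `d`-tuple of `n × n` complex matrices. -/
abbrev MatTuple (d n : ℕ) : Type := Fin d → Matrix (Fin n) (Fin n) ℂ

/-- Evaluation of a free polynomial `p ∈ P^d` at a `d`-tuple of `n × n` matrices: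
the unital algebra homomorphism sending the `r`-th variable to `x r`. -/
noncomputable def evalPoly {d n : ℕ} (p : FreeAlgebra ℂ (Fin d)) (x : MatTuple d n) :
    Matrix (Fin n) (Fin n) ℂ :=
  FreeAlgebra.lift ℂ x p

/-- The operator norm (`ℓ² → ℓ²`) of a square complex matrix. -/
noncomputable def opNorm {ι : Type*} [Fintype ι] [DecidableEq ι] (A : Matrix ι ι ℂ) : ℝ :=
  ‖Matrix.toEuclideanCLM (𝕜 := ℂ) A‖

/-- Evaluation of a `J × J` matrix `δ` of free polynomials at `x ∈ M_n^d`: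
the `Jn × Jn` matrix whose `(i,j)` block is `δ i j` evaluated at `x`. -/
noncomputable def evalMat {d n J : ℕ} (δ : Matrix (Fin J) (Fin J) (FreeAlgebra ℂ (Fin d)))
    (x : MatTuple d n) : Matrix (Fin J × Fin n) (Fin J × Fin n) ℂ :=
  fun a b => evalPoly (δ a.1 b.1) x a.2 b.2

/-- The basic free open set `G_δ = {x : ‖δ(x)‖ < 1}`, at matrix size `n`. -/
noncomputable def Gdel {d J : ℕ} (δ : Matrix (Fin J) (Fin J) (FreeAlgebra ℂ (Fin d))) (n : ℕ) :
    Set (MatTuple d n) :=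
  {x | opNorm (evalMat δ x) < 1}

/-- Direct sum of two square complex matrices. -/
def mdsum {m n : ℕ} (A : Matrix (Fin m) (Fin m) ℂ) (B : Matrix (Fin n) (Fin n) ℂ) :
    Matrix (Fin (m + n)) (Fin (m + n)) ℂ :=
  Matrix.reindex finSumFinEquiv finSumFinEquiv (Matrix.fromBlocks A 0 0 B)

/-- Direct sum of two tuples of matrices (coordinatewise direct sum). -/
def tdsum {d m n : ℕ} (x : MatTuple d m) (y : MatTuple d n) : MatTuple d (m + n) :=
  fun r => mdsum (x r) (y r)

/-- `φ` is an nc-function on the graded domain `D`: it preserves direct sums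
and similarities. -/
structure IsNCFn {d : ℕ} (D : ∀ n, Set (MatTuple d n))
    (φ : ∀ n, MatTuple d n → Matrix (Fin n) (Fin n) ℂ) : Prop where
  map_dsum : ∀ {m n : ℕ} (x : MatTuple d m) (y : MatTuple d n),
      x ∈ D m → y ∈ D n → tdsum x y ∈ D (m + n) →
      φ (m + n) (tdsum x y) = mdsum (φ m x) (φ n y)
  map_sim : ∀ {n : ℕ} (x : MatTuple d n) (s : Matrix (Fin n) (Fin n) ℂ),
      IsUnit s → x ∈ D n → (fun r => s⁻¹ * x r * s) ∈ D n →
      φ n (fun r => s⁻¹ * x r * s) = s⁻¹ * φ n x * s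

/-- `φ` is bounded by `C` on the graded domain `D`. -/
def BddBy {d : ℕ} (D : ∀ n, Set (MatTuple d n))
    (φ : ∀ n, MatTuple d n → Matrix (Fin n) (Fin n) ℂ) (C : ℝ) : Prop :=
  ∀ n, ∀ x ∈ D n, opNorm (φ n x) ≤ C

/-- `D` is open in the free topology: every point has a basic free open
neighbourhood contained in `D`. -/
def IsFreeOpen {d : ℕ} (D : ∀ n, Set (MatTuple d n)) : Prop :=
  ∀ n, ∀ x ∈ D n, ∃ (J : ℕ) (δ : Matrix (Fin J) (Fin J) (FreeAlgebra ℂ (Fin d))),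
    x ∈ Gdel δ n ∧ ∀ m, Gdel δ m ⊆ D m

/-- `φ` is a free holomorphic function on the free open set `U`: every point of `U`
lies in a basic free open subset of `U` on which `φ` is a bounded nc-function. -/
def IsFreeHolo {d : ℕ} (U : ∀ n, Set (MatTuple d n))
    (φ : ∀ n, MatTuple d n → Matrix (Fin n) (Fin n) ℂ) : Prop :=
  ∀ n, ∀ x ∈ U n, ∃ (J : ℕ) (δ : Matrix (Fin J) (Fin J) (FreeAlgebra ℂ (Fin d))),
    x ∈ Gdel δ n ∧ (∀ m, Gdel δ m ⊆ U m) ∧ IsNCFn (Gdel δ) φ ∧ ∃ C, BddBy (Gdel δ) φ C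

/-- `φ` belongs to the closed unit ball of `H^∞(U)`. -/
def MemBallHinf {d : ℕ} (U : ∀ n, Set (MatTuple d n))
    (φ : ∀ n, MatTuple d n → Matrix (Fin n) (Fin n) ℂ) : Prop :=
  IsFreeHolo U φ ∧ BddBy U φ 1

/-- The variety `V_Λ` determined by `Λ` (at matrix size `m`): common zero set of
the free polynomials annihilating `Λ`. -/
def VLam {d n : ℕ} (Λ : MatTuple d n) (m : ℕ) : Set (MatTuple d m) :=
  {x | ∀ p : FreeAlgebra ℂ (Fin d), evalPoly p Λ = 0 → evalPoly p x = 0}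

end

section

open scoped Matrix.Norms.L2Operator
open Filter Topology

section Ascoli

/-- A sequence of graded functions that is equicontinuous and pointwise relatively compact in
every degree has a subsequence converging pointwise in all degrees simultaneously. -/
theorem exists_subseq_tendsto_of_equicontinuous {κ : Type*} [Countable κ] {X E : κ → Type*}
    [∀ k, TopologicalSpace (X k)] [∀ k, TopologicalSpace.SeparableSpace (X k)]
    [∀ k, PseudoMetricSpace (E k)] [∀ k, CompleteSpace (E k)]
    (f : ℕ → ∀ k, X k → E k) (hf : ∀ k, Equicontinuous fun i => f i k)
    (hc : ∀ k x, ∃ C : Set (E k), IsCompact C ∧ ∀ i, f i k x ∈ C) :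
    ∃ σ : ℕ → ℕ, StrictMono σ ∧ ∃ g : ∀ k, X k → E k,
      ∀ k x, Tendsto (fun j => f (σ j) k x) atTop (𝓝 (g k x)) := by
  choose C hC hfC using hc
  choose D hDc hD using fun k => TopologicalSpace.exists_countable_dense (X k)
  have (k : κ) : Countable (D k) := (hDc k).to_subtype
  obtain ⟨a, -, σ, hσ, ha⟩ := (isCompact_univ_pi
      fun p : Σ k, D k => hC p.1 p.2.1).tendsto_subseq
    (x := fun i (p : Σ k, D k) => f i p.1 p.2.1) fun i p _ => hfC p.1 p.2.1 i
  have hlim : ∀ k x, ∃ b, Tendsto (fun j => f (σ j) k x) atTop (𝓝 b) := by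
    intro k x
    refine cauchySeq_tendsto_of_complete (Metric.cauchySeq_iff.2 fun ε hε => ?_)
    obtain ⟨y, hy, hyD⟩ := mem_closure_iff_nhds.1 (hD k x) _
      (Metric.equicontinuousAt_iff_right.1 (hf k x) (ε / 3) (by positivity))
    have hya := tendsto_pi_nhds.1 ha ⟨k, y, hyD⟩
    obtain ⟨N, hN⟩ := Metric.cauchySeq_iff.1 hya.cauchySeq (ε / 3) (by positivity)
    refine ⟨N, fun p hp q hq => ?_⟩
    have h₁ := hy (σ p)
    have h₂ := hN p hp q hq
    have h₃ := hy (σ q)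
    rw [dist_comm] at h₃
    calc dist (f (σ p) k x) (f (σ q) k x)
        ≤ dist (f (σ p) k x) (f (σ p) k y) + dist (f (σ p) k y) (f (σ q) k y)
          + dist (f (σ q) k y) (f (σ q) k x) := dist_triangle4 ..
      _ < ε / 3 + ε / 3 + ε / 3 := by gcongr; exact h₂
      _ = ε := by ring
  choose g hg using hlim
  exact ⟨σ, hσ, g, hg⟩

end Ascoli

section Norm

variable {ι κ : Type*} [Fintype ι] [DecidableEq ι] [Fintype κ] [DecidableEq κ]

theorem opNorm_eq_norm (A : Matrix ι ι ℂ) : opNorm A = ‖A‖ := rfl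

theorem Matrix.l2_opNorm_le_of_forall {A : Matrix ι ι ℂ} {C : ℝ} (hC : 0 ≤ C)
    (h : ∀ v : ι → ℂ, ∑ i, ‖(A.mulVec v) i‖ ^ 2 ≤ C ^ 2 * ∑ i, ‖v i‖ ^ 2) : ‖A‖ ≤ C := by
  rw [Matrix.cstar_norm_def]
  refine ContinuousLinearMap.opNorm_le_bound _ hC fun v => ?_
  refine abs_le_of_sq_le_sq' ?_ (by positivity) |>.2
  rw [mul_pow, EuclideanSpace.norm_sq_eq, EuclideanSpace.norm_sq_eq]
  exact h v

theorem Matrix.sum_norm_mulVec_sq_le (A : Matrix ι ι ℂ) (v : ι → ℂ) :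
    ∑ i, ‖(A.mulVec v) i‖ ^ 2 ≤ ‖A‖ ^ 2 * ∑ i, ‖v i‖ ^ 2 := by
  have h := (Matrix.toEuclideanCLM (𝕜 := ℂ) A).le_opNorm (WithLp.toLp 2 v)
  have h' := pow_le_pow_left₀ (norm_nonneg _) h 2
  rwa [mul_pow, EuclideanSpace.norm_sq_eq, EuclideanSpace.norm_sq_eq] at h'

theorem Matrix.l2_opNorm_submatrix_le (A : Matrix ι ι ℂ) {f g : κ → ι}
    (hf : Function.Injective f) (hg : Function.Injective g) : ‖A.submatrix f g‖ ≤ ‖A‖ := by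
  refine Matrix.l2_opNorm_le_of_forall (norm_nonneg _) fun v => ?_
  set w : ι → ℂ := Function.extend g v 0
  have hw : ∀ j, w (g j) = v j := fun j => hg.extend_apply ..
  have hw' : ∀ k ∉ Set.range g, w k = 0 := fun k hk => by
    simp [w, Function.extend_apply' _ _ _ (by simpa using hk)]
  have hsum : ∀ i, (A.submatrix f g).mulVec v i = A.mulVec w (f i) := fun i => by
    simp only [Matrix.mulVec, dotProduct, Matrix.submatrix_apply]
    exact Fintype.sum_of_injective g hg _ _ (fun k hk => by simp [hw' k hk])
      (fun j => by rw [hw])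
  have hnorm : ∑ j, ‖v j‖ ^ 2 = ∑ k, ‖w k‖ ^ 2 :=
    Fintype.sum_of_injective g hg _ _ (fun k hk => by simp [hw' k hk]) (fun j => by rw [hw])
  rw [hnorm]
  refine le_trans ?_ (A.sum_norm_mulVec_sq_le w)
  simp only [hsum]
  refine (Finset.sum_map Finset.univ ⟨f, hf⟩ fun k => ‖A.mulVec w k‖ ^ 2).symm.trans_le ?_
  exact Finset.sum_le_univ_sum_of_nonneg fun _ => by positivity

theorem Matrix.l2_opNorm_fromBlocks_diag_le (A : Matrix ι ι ℂ) (B : Matrix κ κ ℂ) :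
    ‖Matrix.fromBlocks A 0 0 B‖ ≤ max ‖A‖ ‖B‖ := by
  refine Matrix.l2_opNorm_le_of_forall (by positivity) fun v => ?_
  have hA := A.sum_norm_mulVec_sq_le (v ∘ Sum.inl)
  have hB := B.sum_norm_mulVec_sq_le (v ∘ Sum.inr)
  simp only [Fintype.sum_sum_type, Matrix.fromBlocks_mulVec, Sum.elim_inl, Sum.elim_inr,
    Matrix.zero_mulVec, add_zero, zero_add, mul_add]
  refine add_le_add (hA.trans ?_) (hB.trans ?_) <;> simp only [Function.comp_apply] <;> gcongr
  exacts [le_max_left .., le_max_right ..]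

theorem norm_corner_le_norm_reindex_fromBlocks {n : ℕ} (A B C D : Matrix (Fin n) (Fin n) ℂ) :
    ‖B‖ ≤ ‖Matrix.reindex finSumFinEquiv finSumFinEquiv (Matrix.fromBlocks A B C D)‖ := by
  set M := Matrix.reindex finSumFinEquiv finSumFinEquiv (Matrix.fromBlocks A B C D) with hM
  have hB : B = M.submatrix (Fin.castAdd n) (Fin.natAdd n) := by
    ext i j
    simp [hM, -Fin.natAdd_eq_addNat]
  rw [hB]
  exact M.l2_opNorm_submatrix_le (Fin.castAdd_injective n n) (Fin.natAdd_injective n n)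

end Norm

section DirectSum

variable {d m n J : ℕ}

/-- The block upper triangular tuple with diagonal blocks `y`, `x` and corner `h`. -/
def upperTuple (y h x : MatTuple d n) : MatTuple d (n + n) :=
  fun r => Matrix.reindex finSumFinEquiv finSumFinEquiv (Matrix.fromBlocks (y r) (h r) 0 (x r))

theorem evalPoly_tdsum (p : FreeAlgebra ℂ (Fin d)) (x : MatTuple d m) (y : MatTuple d n) :
    evalPoly p (tdsum x y) = mdsum (evalPoly p x) (evalPoly p y) := by
  unfold evalPoly
  induction p using FreeAlgebra.induction with
  | grade0 c =>
    have h := Matrix.fromBlocks_smul c (1 : Matrix (Fin m) (Fin m) ℂ) 0 0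
      (1 : Matrix (Fin n) (Fin n) ℂ)
    simp only [smul_zero, Matrix.fromBlocks_one] at h
    simp only [AlgHom.commutes]
    simp [mdsum, Algebra.algebraMap_eq_smul_one, ← h, Matrix.submatrix_smul]
  | grade1 r => simp [tdsum]
  | mul p q hp hq =>
    simp only [map_mul, hp, hq, mdsum, Matrix.reindex_apply]
    rw [Matrix.submatrix_mul_equiv]
    simp [Matrix.fromBlocks_multiply]
  | add p q hp hq =>
    simp only [map_add, hp, hq, mdsum, Matrix.reindex_apply]
    simpa [Matrix.fromBlocks_add] using (congr_fun₂ (Matrix.submatrix_add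
      (Matrix.fromBlocks (FreeAlgebra.lift ℂ x p) 0 0 (FreeAlgebra.lift ℂ y p))
      (Matrix.fromBlocks (FreeAlgebra.lift ℂ x q) 0 0 (FreeAlgebra.lift ℂ y q)))
      finSumFinEquiv.symm finSumFinEquiv.symm).symm

theorem evalMat_tdsum (δ : Matrix (Fin J) (Fin J) (FreeAlgebra ℂ (Fin d)))
    (x : MatTuple d m) (y : MatTuple d n) :
    (evalMat δ (tdsum x y)).submatrix
        (Sum.elim (Prod.map id (Fin.castAdd n)) (Prod.map id (Fin.natAdd m)))
        (Sum.elim (Prod.map id (Fin.castAdd n)) (Prod.map id (Fin.natAdd m))) =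
      Matrix.fromBlocks (evalMat δ x) 0 0 (evalMat δ y) := by
  ext (⟨i, a⟩ | ⟨i, a⟩) (⟨j, b⟩ | ⟨j, b⟩) <;>
    simp [evalMat, evalPoly_tdsum, mdsum]

theorem tdsum_mem_Gdel_iff {δ : Matrix (Fin J) (Fin J) (FreeAlgebra ℂ (Fin d))}
    {x : MatTuple d m} {y : MatTuple d n} :
    tdsum x y ∈ Gdel δ (m + n) ↔ x ∈ Gdel δ m ∧ y ∈ Gdel δ n := by
  let e : Fin J × Fin (m + n) ≃ (Fin J × Fin m) ⊕ (Fin J × Fin n) :=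
    ((Equiv.refl _).prodCongr finSumFinEquiv.symm).trans (Equiv.prodSumDistrib ..)
  have he : (e.symm : _ → _) =
      Sum.elim (Prod.map id (Fin.castAdd n)) (Prod.map id (Fin.natAdd m)) := by
    ext (_ | _) <;> rfl
  have h := evalMat_tdsum δ x y
  rw [← he] at h
  have h' : evalMat δ (tdsum x y) =
      (Matrix.fromBlocks (evalMat δ x) 0 0 (evalMat δ y)).submatrix e e := by
    rw [← h]; simp
  simp only [Gdel, Set.mem_ofPred_eq, opNorm_eq_norm]
  constructor
  · refine fun hlt => ⟨lt_of_le_of_lt ?_ hlt, lt_of_le_of_lt ?_ hlt⟩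
    · have : evalMat δ x = (evalMat δ (tdsum x y)).submatrix (e.symm ∘ Sum.inl)
          (e.symm ∘ Sum.inl) := by
        rw [← Matrix.submatrix_submatrix, h]; rfl
      rw [this]
      exact Matrix.l2_opNorm_submatrix_le _ (e.symm.injective.comp Sum.inl_injective)
        (e.symm.injective.comp Sum.inl_injective)
    · have : evalMat δ y = (evalMat δ (tdsum x y)).submatrix (e.symm ∘ Sum.inr)
          (e.symm ∘ Sum.inr) := by
        rw [← Matrix.submatrix_submatrix, h]; rfl
      rw [this]
      exact Matrix.l2_opNorm_submatrix_le _ (e.symm.injective.comp Sum.inr_injective)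
        (e.symm.injective.comp Sum.inr_injective)
  · rintro ⟨hx, hy⟩
    rw [h']
    exact (Matrix.l2_opNorm_submatrix_le _ e.injective e.injective).trans_lt
      ((Matrix.l2_opNorm_fromBlocks_diag_le _ _).trans_lt (max_lt hx hy))

end DirectSum

section Continuity

variable {d n J : ℕ}

theorem continuous_evalPoly (p : FreeAlgebra ℂ (Fin d)) :
    Continuous fun x : MatTuple d n => evalPoly p x := by
  unfold evalPoly
  induction p using FreeAlgebra.induction with
  | grade0 c => simpa only [AlgHom.commutes] using continuous_const
  | grade1 r => simpa using continuous_apply r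
  | mul p q hp hq => 
    simp only [map_mul]
    fun_prop
  | add p q hp hq => 
    simp only [map_add]
    fun_prop

theorem isOpen_Gdel (δ : Matrix (Fin J) (Fin J) (FreeAlgebra ℂ (Fin d))) :
    IsOpen (Gdel δ n) := by
  have h : Continuous fun x : MatTuple d n => evalMat δ x :=
    continuous_matrix fun a b => (continuous_evalPoly (δ a.1 b.1)).matrix_elem a.2 b.2
  exact isOpen_lt h.norm continuous_const

theorem continuous_upperTuple (x : MatTuple d n) :
    Continuous fun q : MatTuple d n × MatTuple d n => upperTuple q.1 q.2 x := by
  refine continuous_pi fun r => Continuous.matrix_reindex ?_ _ _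
  exact Continuous.matrix_fromBlocks (by fun_prop) (by fun_prop) continuous_const continuous_const

end Continuity

section NCFunction

variable {d : ℕ} {U : ∀ n, Set (MatTuple d n)}
  {φ : ∀ n, MatTuple d n → Matrix (Fin n) (Fin n) ℂ}

/-- A free holomorphic function on `U` is an nc-function on every basic free open subset of `U`. -/
theorem IsFreeHolo.isNCFn_Gdel (hφ : IsFreeHolo U φ) {J : ℕ}
    {δ : Matrix (Fin J) (Fin J) (FreeAlgebra ℂ (Fin d))} (hδ : ∀ m, Gdel δ m ⊆ U m) :
    IsNCFn (Gdel δ) φ where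
  map_dsum x y _ _ hxy := by
    obtain ⟨_, ε, hε, -, hnc, -⟩ := hφ _ _ (hδ _ hxy)
    obtain ⟨hx, hy⟩ := tdsum_mem_Gdel_iff.1 hε
    exact hnc.map_dsum x y hx hy hε
  map_sim x s hs hx hxs := by
    obtain ⟨_, ε, hε, -, hnc, -⟩ := hφ _ _ (hδ _ (tdsum_mem_Gdel_iff.2 ⟨hx, hxs⟩))
    obtain ⟨hx', hxs'⟩ := tdsum_mem_Gdel_iff.1 hε
    exact hnc.map_sim x s hs hx' hxs'

/-- An nc-function maps `[y, t(y - x); 0, x]` to `[φ y, t(φ y - φ x); 0, φ x]`. -/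
theorem IsNCFn.map_upperTuple (hφ : IsNCFn U φ) {n : ℕ} {x y : MatTuple d n} (t : ℂ)
    (hx : x ∈ U n) (hy : y ∈ U n) (hyx : tdsum y x ∈ U (n + n))
    (ht : upperTuple y (t • (y - x)) x ∈ U (n + n)) :
    φ (n + n) (upperTuple y (t • (y - x)) x) =
      Matrix.reindex finSumFinEquiv finSumFinEquiv
        (Matrix.fromBlocks (φ n y) (t • (φ n y - φ n x)) 0 (φ n x)) := by
  let u (c : ℂ) : Matrix (Fin (n + n)) (Fin (n + n)) ℂ :=
    Matrix.reindex finSumFinEquiv finSumFinEquiv (Matrix.fromBlocks 1 (c • 1) 0 1)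
  have hu (c : ℂ) : u c * u (-c) = 1 := by
    simp only [u, Matrix.reindex_apply]
    rw [Matrix.submatrix_mul_equiv]
    simp [Matrix.fromBlocks_multiply]
  have hinv : (u t)⁻¹ = u (-t) := Matrix.inv_eq_right_inv (hu t)
  have hconj (a b : Matrix (Fin n) (Fin n) ℂ) : (u t)⁻¹ * mdsum a b * u t =
      Matrix.reindex finSumFinEquiv finSumFinEquiv
        (Matrix.fromBlocks a (t • (a - b)) 0 b) := by
    rw [hinv]
    simp only [u, mdsum, Matrix.reindex_apply]
    rw [Matrix.submatrix_mul_equiv, Matrix.submatrix_mul_equiv]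
    simp [Matrix.fromBlocks_multiply, sub_eq_add_neg]
  have hpt : (fun r => (u t)⁻¹ * tdsum y x r * u t) = upperTuple y (t • (y - x)) x := by
    funext r
    exact hconj (y r) (x r)
  have hunit : IsUnit (u t) := IsUnit.of_mul_eq_one _ (hu t)
  have h := hφ.map_sim (tdsum y x) (u t) hunit hyx (hpt ▸ ht)
  rw [hpt, hφ.map_dsum y x hy hx hyx, hconj] at h
  exact h

/-- The closed unit ball of `H^∞(U)` is locally uniformly Lipschitz. -/
theorem exists_local_lipschitz (hU : IsFreeOpen U) {n : ℕ} {x : MatTuple d n} (hx : x ∈ U n) :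
    ∃ C : ℝ, ∃ r > 0, ∀ φ, MemBallHinf U φ → ∀ y, dist y x < r →
      dist (φ n x) (φ n y) ≤ C * dist y x := by
  obtain ⟨J, δ, hxδ, hδU⟩ := hU n x hx
  have hV : {q : MatTuple d n × MatTuple d n | upperTuple q.1 q.2 x ∈ Gdel δ (n + n)} ∈
      𝓝 (x, 0) := by
    refine ((isOpen_Gdel δ).preimage (continuous_upperTuple x)).mem_nhds ?_
    exact tdsum_mem_Gdel_iff.2 ⟨hxδ, hxδ⟩
  obtain ⟨r, hr, hball⟩ := Metric.mem_nhds_iff.1 hV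
  have hmem {y h : MatTuple d n} (hy : dist y x < r) (hh : ‖h‖ < r) :
      upperTuple y h x ∈ Gdel δ (n + n) :=
    hball (a := (y, h)) (by simpa [Prod.dist_eq] using ⟨hy, hh⟩)
  refine ⟨2 / r, r, hr, fun φ hφ y hy => ?_⟩
  rcases eq_or_ne y x with rfl | hne
  · simp
  have hdist : 0 < dist y x := dist_pos.2 hne
  set t : ℝ := r / (2 * dist y x)
  have ht : 0 < t := by positivity
  have hth : ‖(t : ℂ) • (y - x)‖ < r := by
    rw [norm_smul, ← dist_eq_norm, Complex.norm_real, Real.norm_of_nonneg ht.le]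
    have : t * dist y x = r / 2 := by simp only [t]; field_simp
    linarith
  have hyx : tdsum y x ∈ Gdel δ (n + n) := hmem (h := 0) hy (by simpa using hr)
  have hT := hmem hy hth
  have hval := (hφ.1.isNCFn_Gdel hδU).map_upperTuple (t : ℂ) hxδ
    (tdsum_mem_Gdel_iff.1 hyx).1 hyx hT
  have hle := hφ.2 _ _ (hδU _ hT)
  rw [hval, opNorm_eq_norm] at hle
  have hcorner : ‖(t : ℂ) • (φ n y - φ n x)‖ ≤ 1 := by
    exact (norm_corner_le_norm_reindex_fromBlocks _ _ _ _).trans hle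
  rw [norm_smul, ← dist_eq_norm, Complex.norm_real, Real.norm_of_nonneg ht.le] at hcorner
  rw [dist_comm]
  calc dist (φ n y) (φ n x) ≤ 1 / t := by rwa [le_div_iff₀' ht]
    _ = 2 / r * dist y x := by simp only [t]; field_simp

/-- The closed unit ball of `H^∞(U)` is equicontinuous on each `U ∩ M_n^d`. -/
theorem equicontinuous_of_memBallHinf {ι : Type*} (hU : IsFreeOpen U)
    {φs : ι → ∀ n, MatTuple d n → Matrix (Fin n) (Fin n) ℂ} (hφs : ∀ i, MemBallHinf U (φs i))
    (n : ℕ) : Equicontinuous fun i (x : U n) => φs i n x := by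
  rintro ⟨x, hx⟩
  obtain ⟨C, r, hr, h⟩ := exists_local_lipschitz hU hx
  have hcont : Tendsto (fun y : U n => C * dist y.1 x) (𝓝 ⟨x, hx⟩) (𝓝 0) := by
    have : Continuous fun y : U n => C * dist y.1 x := by fun_prop
    simpa using this.tendsto ⟨x, hx⟩
  refine Metric.equicontinuousAt_of_continuity_modulus _ hcont _ ?_
  filter_upwards [Metric.ball_mem_nhds (⟨x, hx⟩ : U n) hr] with y hy i
  exact h _ (hφs i) y hy

/-- Pointwise limits of sequences of nc-functions are nc-functions. -/
theorem IsNCFn.of_tendsto {φs : ℕ → ∀ n, MatTuple d n → Matrix (Fin n) (Fin n) ℂ}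
    (hφs : ∀ i, IsNCFn U (φs i))
    (hlim : ∀ n, ∀ x ∈ U n, Tendsto (fun i => φs i n x) atTop (𝓝 (φ n x))) : IsNCFn U φ where
  map_dsum {m n} x y hx hy hxy := by
    refine tendsto_nhds_unique (hlim _ _ hxy) ?_
    simp only [fun i => (hφs i).map_dsum x y hx hy hxy, mdsum]
    have hcont : Continuous fun q : Matrix (Fin m) (Fin m) ℂ × Matrix (Fin n) (Fin n) ℂ =>
        Matrix.reindex finSumFinEquiv finSumFinEquiv (Matrix.fromBlocks q.1 0 0 q.2) :=
      (continuous_fst.matrix_fromBlocks continuous_const continuous_const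
        continuous_snd).matrix_reindex _ _
    exact (hcont.tendsto _).comp ((hlim _ x hx).prodMk_nhds (hlim _ y hy))
  map_sim x s hs hx hxs := by
    refine tendsto_nhds_unique (hlim _ _ hxs) ?_
    simp only [fun i => (hφs i).map_sim x s hs hx hxs]
    exact ((hlim _ x hx).const_mul _).mul_const _

/-- The closed unit ball of `H^∞(U)` is closed under pointwise limits of sequences. -/
theorem MemBallHinf.of_tendsto (hU : IsFreeOpen U)
    {φs : ℕ → ∀ n, MatTuple d n → Matrix (Fin n) (Fin n) ℂ} (hφs : ∀ i, MemBallHinf U (φs i))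
    (hlim : ∀ n, ∀ x ∈ U n, Tendsto (fun i => φs i n x) atTop (𝓝 (φ n x))) :
    MemBallHinf U φ := by
  have hbdd : BddBy U φ 1 := fun n x hx =>
    le_of_tendsto (hlim n x hx).norm (Eventually.of_forall fun i => (hφs i).2 n x hx)
  refine ⟨fun n x hx => ?_, hbdd⟩
  obtain ⟨J, δ, hxδ, hδU⟩ := hU n x hx
  exact ⟨J, δ, hxδ, hδU,
    IsNCFn.of_tendsto (fun i => (hφs i).1.isNCFn_Gdel hδU) fun m y hy => hlim m y (hδU m hy),
    1, fun m y hy => hbdd m y (hδU m hy)⟩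

end NCFunction

theorem exists_subseq_tendstoUniformlyOn_of_memBallHinf {d : ℕ}
    {U : ∀ n, Set (MatTuple d n)} (hU : IsFreeOpen U)
    {φs : ℕ → ∀ n, MatTuple d n → Matrix (Fin n) (Fin n) ℂ}
    (hφs : ∀ i, MemBallHinf U (φs i)) :
    ∃ σ : ℕ → ℕ, StrictMono σ ∧
      ∃ φ : ∀ n, MatTuple d n → Matrix (Fin n) (Fin n) ℂ, MemBallHinf U φ ∧
        ∀ n, ∀ K : Set (MatTuple d n), K ⊆ U n → IsCompact K →
          TendstoUniformlyOn (fun j x => φs (σ j) n x) (φ n) Filter.atTop K := by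
  have hproper (n : ℕ) : ProperSpace (Matrix (Fin n) (Fin n) ℂ) := FiniteDimensional.proper ℂ _
  obtain ⟨σ, hσ, g, hg⟩ := exists_subseq_tendsto_of_equicontinuous
    (X := fun n => U n) (fun i n x => φs i n x) (equicontinuous_of_memBallHinf hU hφs)
    fun n x => ⟨Metric.closedBall 0 1, isCompact_closedBall _ _, fun i => by
      simpa [opNorm_eq_norm] using (hφs i).2 n x x.2⟩
  classical
  let φ (n : ℕ) (x : MatTuple d n) : Matrix (Fin n) (Fin n) ℂ :=
    if hx : x ∈ U n then g n ⟨x, hx⟩ else 0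
  have hlim : ∀ n, ∀ x ∈ U n, Tendsto (fun j => φs (σ j) n x) atTop (𝓝 (φ n x)) := by
    intro n x hx
    simpa only [φ, hx, dif_pos] using hg n ⟨x, hx⟩
  refine ⟨σ, hσ, φ, MemBallHinf.of_tendsto hU (fun j => hφs (σ j)) hlim, fun n K hKU hK => ?_⟩
  have : CompactSpace K := isCompact_iff_compactSpace.1 hK
  have heq : Equicontinuous fun j (x : K) => φs (σ j) n x := fun x V hV =>
    ((continuous_inclusion hKU).tendsto x).eventually
      (equicontinuous_of_memBallHinf hU (fun j => hφs (σ j)) n (Set.inclusion hKU x) V hV)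
  rw [tendstoUniformlyOn_iff_tendstoUniformly_comp_coe]
  exact UniformFun.tendsto_iff_tendstoUniformly.1
    ((heq.tendsto_uniformFun_iff_pi atTop _).2
      (tendsto_pi_nhds.2 fun x => hlim n x (hKU x.2)))

end

/-- **Theorem 2.4 (Montel).**  A sequence in the closed unit ball of `H^∞(U)` has a
subsequence converging, uniformly on compact subsets of `U ∩ M_n^d` for every `n`
(i.e. locally uniformly in the disjoint union topology), to a function in the closed
unit ball of `H^∞(U)`. -/
theorem montel {d : ℕ} (hd : 0 < d)
    (U : ∀ n, Set (MatTuple d n)) (hU : IsFreeOpen U)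
    (φs : ℕ → ∀ n, MatTuple d n → Matrix (Fin n) (Fin n) ℂ)
    (hφs : ∀ i, MemBallHinf U (φs i)) :
    ∃ σ : ℕ → ℕ, StrictMono σ ∧
      ∃ φ : ∀ n, MatTuple d n → Matrix (Fin n) (Fin n) ℂ, MemBallHinf U φ ∧
        ∀ n, ∀ K : Set (MatTuple d n), K ⊆ U n → IsCompact K →
          TendstoUniformlyOn (fun j x => φs (σ j) n x) (φ n) Filter.atTop K := by
  exact exists_subseq_tendstoUniformlyOn_of_memBallHinf hU hφs
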